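/- The following equality holds in A: ⟨ĥ, (g_L^{-2})_{(1)}⟩ (g_L^{-2})_{(2)} = ⟨ĥ, (g_R^{-2})_{(2)}⟩ (g_R^{-2})_{(1)}. Moreover, this element ȷ is positive, invertible, satisfies S(ȷ) = ȷ, and is hypercentral, i.e. ȷ ∈ A^L ∩ A^R ∩ Z(A). -/

import Mathlib

open scoped TensorProduct

noncomputable section

/-- An element of a `C*`-algebra is positive iff it is of the form `star y * y`. -/
def IsPosElem {A : Type*} [Mul A] [Star A] (x : A) : Prop := ∃ y : A, x = star y * y

section Helpers

variable {A : Type*} [NormedRing A] [StarRing A] [CStarRing A]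
  [NormedAlgebra ℂ A] [StarModule ℂ A]

/-- Apply a linear functional to the first leg of a tensor (`⟨φ, u₁⟩ u₂`). -/
def lapp (φ : A →ₗ[ℂ] ℂ) : A ⊗[ℂ] A →ₗ[ℂ] A :=
  (TensorProduct.lid ℂ A).toLinearMap ∘ₗ TensorProduct.map φ LinearMap.id

/-- Apply a linear functional to the second leg of a tensor (`⟨φ, u₂⟩ u₁`). -/
def rapp (φ : A →ₗ[ℂ] ℂ) : A ⊗[ℂ] A →ₗ[ℂ] A :=
  (TensorProduct.rid ℂ A).toLinearMap ∘ₗ TensorProduct.map LinearMap.id φ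

/-- Apply a pair of linear functionals to the two legs of a tensor (`⟨φ, u₁⟩⟨ψ, u₂⟩`). -/
def papp (φ ψ : A →ₗ[ℂ] ℂ) : A ⊗[ℂ] A →ₗ[ℂ] ℂ :=
  (TensorProduct.lid ℂ ℂ).toLinearMap ∘ₗ TensorProduct.map φ ψ

end Helpers

/-- A `C*`-weak Hopf algebra: a finite-dimensional unital `C*`-algebra `A` equipped with a
comultiplication `Δ` (written in Sweedler notation `Δ x = x₍₁₎ ⊗ x₍₂₎`), counit `ε` and
antipode `S`, satisfying the axioms of Böhm–Szlachányi.  The field `starT` is the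
(componentwise) star operation on `A ⊗[ℂ] A`, characterized by additivity and its values on
pure tensors. -/
structure WeakHopfData (A : Type*) [NormedRing A] [StarRing A] [CStarRing A]
    [NormedAlgebra ℂ A] [StarModule ℂ A] [FiniteDimensional ℂ A] : Type _ where
  Δ : A →ₗ[ℂ] A ⊗[ℂ] A
  ε : A →ₗ[ℂ] ℂ
  S : A ≃ₗ[ℂ] A
  starT : A ⊗[ℂ] A → A ⊗[ℂ] A
  starT_add : ∀ u v : A ⊗[ℂ] A, starT (u + v) = starT u + starT v
  starT_tmul : ∀ a b : A, starT (a ⊗ₜ[ℂ] b) = star a ⊗ₜ[ℂ] star b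
  /-- coassociativity of the comultiplication -/
  coassoc : (TensorProduct.assoc ℂ A A A).toLinearMap ∘ₗ
      (TensorProduct.map Δ LinearMap.id) ∘ₗ Δ = (TensorProduct.map LinearMap.id Δ) ∘ₗ Δ
  /-- counit axiom, left version -/
  counit_left : (TensorProduct.lid ℂ A).toLinearMap ∘ₗ (TensorProduct.map ε LinearMap.id) ∘ₗ Δ
      = LinearMap.id
  /-- counit axiom, right version -/
  counit_right : (TensorProduct.rid ℂ A).toLinearMap ∘ₗ (TensorProduct.map LinearMap.id ε) ∘ₗ Δ
      = LinearMap.id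
  /-- the comultiplication is multiplicative -/
  Δ_mul : ∀ x y : A, Δ (x * y) = Δ x * Δ y
  /-- the star operation is comultiplicative -/
  Δ_star : ∀ x : A, Δ (star x) = starT (Δ x)
  /-- the unit is weakly comultiplicative:
  `(Δ ⊗ id)(Δ 1) = (Δ 1 ⊗ 1)(1 ⊗ Δ 1)` -/
  Δ_one_weak : (TensorProduct.map Δ LinearMap.id) (Δ 1)
      = (Δ 1 ⊗ₜ[ℂ] (1 : A)) * ((TensorProduct.assoc ℂ A A A).symm ((1 : A) ⊗ₜ[ℂ] Δ 1))
  /-- the unit is weakly comultiplicative: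
  `(Δ ⊗ id)(Δ 1) = (1 ⊗ Δ 1)(Δ 1 ⊗ 1)` -/
  Δ_one_weak' : (TensorProduct.map Δ LinearMap.id) (Δ 1)
      = ((TensorProduct.assoc ℂ A A A).symm ((1 : A) ⊗ₜ[ℂ] Δ 1)) * (Δ 1 ⊗ₜ[ℂ] (1 : A))
  /-- the counit is weakly multiplicative: `ε (x y z) = ε (x y₍₁₎) ε (y₍₂₎ z)` -/
  ε_weak : ∀ x y z : A,
      ε (x * y * z) = papp (ε ∘ₗ LinearMap.mulLeft ℂ x) (ε ∘ₗ LinearMap.mulRight ℂ z) (Δ y)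
  /-- the counit is weakly multiplicative: `ε (x y z) = ε (x y₍₂₎) ε (y₍₁₎ z)` -/
  ε_weak' : ∀ x y z : A,
      ε (x * y * z) = papp (ε ∘ₗ LinearMap.mulRight ℂ z) (ε ∘ₗ LinearMap.mulLeft ℂ x) (Δ y)
  /-- antipode axiom: `x₍₁₎ S(x₍₂₎) = ε (1₍₁₎ x) 1₍₂₎` -/
  antipode_left : ∀ x : A,
      LinearMap.mul' ℂ A ((TensorProduct.map LinearMap.id S.toLinearMap) (Δ x))
        = lapp (ε ∘ₗ LinearMap.mulRight ℂ x) (Δ 1)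
  /-- antipode axiom: `S(x₍₁₎) x₍₂₎ = 1₍₁₎ ε (x 1₍₂₎)` -/
  antipode_right : ∀ x : A,
      LinearMap.mul' ℂ A ((TensorProduct.map S.toLinearMap LinearMap.id) (Δ x))
        = rapp (ε ∘ₗ LinearMap.mulLeft ℂ x) (Δ 1)
  /-- the antipode is antimultiplicative -/
  S_antimul : ∀ x y : A, S (x * y) = S y * S x
  /-- the antipode is anticomultiplicative -/
  S_anticomul : ∀ x : A,
      Δ (S x) = (TensorProduct.comm ℂ A A) ((TensorProduct.map S.toLinearMap S.toLinearMap) (Δ x))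

namespace WeakHopfData

variable {A : Type*} [NormedRing A] [StarRing A] [CStarRing A]
  [NormedAlgebra ℂ A] [StarModule ℂ A] [FiniteDimensional ℂ A]

/-- The source counital map `ε^L (x) = x₍₁₎ S(x₍₂₎)`. -/
def εL (W : WeakHopfData A) : A →ₗ[ℂ] A :=
  LinearMap.mul' ℂ A ∘ₗ TensorProduct.map LinearMap.id W.S.toLinearMap ∘ₗ W.Δ

/-- The target counital map `ε^R (x) = S(x₍₁₎) x₍₂₎`. -/
def εR (W : WeakHopfData A) : A →ₗ[ℂ] A :=
  LinearMap.mul' ℂ A ∘ₗ TensorProduct.map W.S.toLinearMap LinearMap.id ∘ₗ W.Δ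

/-- Full contraction of the iterated coproduct `Δ⁽ⁿ⁾ x = x₍₁₎ ⊗ ⋯ ⊗ x₍ₙ₊₁₎` against a family
of `n+1` linear functionals: `sweedlerEval W n φ x = ⟨φ 0, x₍₁₎⟩ ⋯ ⟨φ n, x₍ₙ₊₁₎⟩`.
Since linear functionals separate the points of a tensor power, identities between iterated
coproducts are faithfully expressed through these contractions. -/
def sweedlerEval (W : WeakHopfData A) : (n : ℕ) → (Fin (n + 1) → (A →ₗ[ℂ] ℂ)) → (A →ₗ[ℂ] ℂ)
  | 0, φ => φ 0
  | n + 1, φ => papp (sweedlerEval W n (Fin.init φ)) (φ (Fin.last (n + 1))) ∘ₗ W.Δ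

end WeakHopfData

/-- A `C*`-weak Hopf algebra together with its canonical distinguished elements:
the Haar integral `h`, the dual Haar integral `hHat`, the square roots `gL`, `gR` of
`E^L h`, `E^R h` (whence the canonical grouplike element `g = gL * gR⁻¹`), real powers
`gLpow`, `gRpow` of `gL` and `gR`, and a positive square root operation `sqrt`;
all characterized by the (uniquely determining) properties listed as fields. -/
structure HaarPkg (A : Type*) [NormedRing A] [StarRing A] [CStarRing A]
    [NormedAlgebra ℂ A] [StarModule ℂ A] [FiniteDimensional ℂ A] : Type _ where
  W : WeakHopfData A
  /-- the Haar integral -/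
  h : A
  haar_left : ∀ x : A, x * h = WeakHopfData.εL W x * h
  haar_right : ∀ x : A, h * x = h * WeakHopfData.εR W x
  haar_counitL : WeakHopfData.εL W h = 1
  haar_counitR : WeakHopfData.εR W h = 1
  haar_idem : h * h = h
  haar_star : star h = h
  haar_S : W.S h = h
  haar_nondeg : ∀ y : A, ∃ φ ψ : A →ₗ[ℂ] ℂ, lapp φ (W.Δ h) = y ∧ rapp ψ (W.Δ h) = y
  /-- the Haar integral of the dual weak Hopf algebra `A*`, as a linear functional on `A` -/
  hHat : A →ₗ[ℂ] ℂ
  hHat_pos : ∀ x : A, ∃ r : ℝ, 0 ≤ r ∧ hHat (star x * x) = (r : ℂ)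
  hHat_S : ∀ x : A, hHat (W.S x) = hHat x
  /-- `gL = (E^L h)^{1/2}` -/
  gL : A
  /-- `gR = (E^R h)^{1/2}` -/
  gR : A
  gL_pos : IsPosElem gL
  gR_pos : IsPosElem gR
  gL_unit : IsUnit gL
  gR_unit : IsUnit gR
  gL_sq : gL * gL = rapp hHat (W.Δ h)
  gR_sq : gR * gR = lapp hHat (W.Δ h)
  gL_mem : gL ∈ Set.range (WeakHopfData.εL W)
  gR_mem : gR ∈ Set.range (WeakHopfData.εR W)
  gR_S : gR = W.S gL
  gLR_comm : gL * gR = gR * gL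
  /-- the canonical grouplike element `g = gL * gR⁻¹` is positive -/
  g_pos : IsPosElem (gL * Ring.inverse gR)
  g_unit : IsUnit (gL * Ring.inverse gR)
  /-- `Δ g = (g ⊗ g) Δ 1` -/
  g_grouplike : W.Δ (gL * Ring.inverse gR)
      = ((gL * Ring.inverse gR) ⊗ₜ[ℂ] (gL * Ring.inverse gR)) * W.Δ 1
  /-- `Δ g = Δ 1 (g ⊗ g)` -/
  g_grouplike' : W.Δ (gL * Ring.inverse gR)
      = W.Δ 1 * ((gL * Ring.inverse gR) ⊗ₜ[ℂ] (gL * Ring.inverse gR))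
  /-- `S g = g⁻¹` -/
  g_S : W.S (gL * Ring.inverse gR) = Ring.inverse (gL * Ring.inverse gR)
  /-- `S² x = g x g⁻¹` -/
  S_sq : ∀ x : A,
      W.S (W.S x) = (gL * Ring.inverse gR) * x * Ring.inverse (gL * Ring.inverse gR)
  /-- `h₍₁₎ ⊗ g h₍₂₎ g = h₍₂₎ ⊗ h₍₁₎` -/
  haar_flip : TensorProduct.map LinearMap.id
      (LinearMap.mulLeft ℂ (gL * Ring.inverse gR) ∘ₗ LinearMap.mulRight ℂ (gL * Ring.inverse gR))
      (W.Δ h) = (TensorProduct.comm ℂ A A) (W.Δ h)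
  /-- dual integral relation `⟨ĥ, x (h gL⁻²)⟩ = ε x` -/
  hHat_dual₁ : ∀ x : A, hHat (x * (h * (Ring.inverse gL * Ring.inverse gL))) = W.ε x
  /-- dual integral relation `⟨ĥ, (gR⁻² h) x⟩ = ε x` -/
  hHat_dual₂ : ∀ x : A, hHat ((Ring.inverse gR * Ring.inverse gR * h) * x) = W.ε x
  /-- dual integral relation `⟨ĥ, (h gL⁻²)₍₂₎⟩ (h gL⁻²)₍₁₎ = 1` -/
  hHat_dual₃ : rapp hHat (W.Δ (h * (Ring.inverse gL * Ring.inverse gL))) = 1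
  /-- dual integral relation `⟨ĥ, (gR⁻² h)₍₁₎⟩ (gR⁻² h)₍₂₎ = 1` -/
  hHat_dual₄ : lapp hHat (W.Δ (Ring.inverse gR * Ring.inverse gR * h)) = 1
  /-- the positive square root, via the continuous functional calculus -/
  sqrt : A → A
  sqrt_pos : ∀ x : A, IsPosElem x → IsPosElem (sqrt x)
  sqrt_mul_self : ∀ x : A, IsPosElem x → sqrt x * sqrt x = x
  /-- real powers of `gL`, via the continuous functional calculus -/
  gLpow : ℝ → A
  /-- real powers of `gR`, via the continuous functional calculus -/
  gRpow : ℝ → A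
  gLpow_one : gLpow 1 = gL
  gRpow_one : gRpow 1 = gR
  gLpow_zero : gLpow 0 = 1
  gRpow_zero : gRpow 0 = 1
  gLpow_add : ∀ s t : ℝ, gLpow (s + t) = gLpow s * gLpow t
  gRpow_add : ∀ s t : ℝ, gRpow (s + t) = gRpow s * gRpow t
  gLpow_pos : ∀ t : ℝ, IsPosElem (gLpow t)
  gRpow_pos : ∀ t : ℝ, IsPosElem (gRpow t)
  gLpow_continuous : Continuous gLpow
  gRpow_continuous : Continuous gRpow

namespace HaarPkg

variable {A : Type*} [NormedRing A] [StarRing A] [CStarRing A]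
  [NormedAlgebra ℂ A] [StarModule ℂ A] [FiniteDimensional ℂ A]
variable (P : HaarPkg A)

/-- The canonical grouplike element `g = gL gR⁻¹`. -/
def g : A := P.gL * Ring.inverse P.gR

/-- The Watatani index `ı = ε^L (h gL⁻²)` of the Haar conditional expectations. -/
def iotaEl : A := WeakHopfData.εL P.W (P.h * (Ring.inverse P.gL * Ring.inverse P.gL))

/-- The element `ȷ = ⟨ĥ, (gL⁻²)₍₁₎⟩ (gL⁻²)₍₂₎`, the dual analogue of the Watatani index. -/
def jayEl : A := lapp P.hHat (P.W.Δ (Ring.inverse P.gL * Ring.inverse P.gL))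

/-- The pulling-through element `Ω = ı⁻¹ gL⁻¹ h gL⁻¹`. -/
def Ω : A := Ring.inverse P.iotaEl * Ring.inverse P.gL * P.h * Ring.inverse P.gL

/-- The map `J x = g^{-1/2} S(x) g^{1/2}`, as a linear map. -/
def Jlin : A →ₗ[ℂ] A :=
  LinearMap.mulRight ℂ (P.sqrt P.g) ∘ₗ
    LinearMap.mulLeft ℂ (Ring.inverse (P.sqrt P.g)) ∘ₗ P.W.S.toLinearMap

/-- The functional `⟨ω, x⟩ = ⟨ĥ, ȷ⁻¹ gL⁻¹ gR⁻¹ x⟩` (the dual analogue of `Ω`). -/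
def ω : A →ₗ[ℂ] ℂ :=
  P.hHat ∘ₗ LinearMap.mulLeft ℂ (Ring.inverse P.jayEl * (Ring.inverse P.gL * Ring.inverse P.gR))

/-- `ξ_L = ı^{1/2} ȷ^{1/2} gL`. -/
def ξL : A := P.sqrt P.iotaEl * P.sqrt P.jayEl * P.gL

/-- `ξ_R = ı^{1/2} ȷ^{1/2} gR`. -/
def ξR : A := P.sqrt P.iotaEl * P.sqrt P.jayEl * P.gR

/-- `ξ = ξ_L ξ_R`. -/
def ξ : A := P.ξL * P.ξR

/-- `J^L x = gL⁻¹ S(x) gL`. -/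
def JL : A → A := fun x => Ring.inverse P.gL * P.W.S x * P.gL

/-- `J^R x = gL S⁻¹(x) gL⁻¹`. -/
def JR : A → A := fun x => P.gL * P.W.S.symm x * Ring.inverse P.gL

end HaarPkg

section Legs

variable {A : Type*} [NormedRing A] [NormedAlgebra ℂ A]

@[simp] lemma lapp_tmul (φ : A →ₗ[ℂ] ℂ) (a b : A) : lapp φ (a ⊗ₜ[ℂ] b) = φ a • b := by
  simp [lapp]

@[simp] lemma rapp_tmul (φ : A →ₗ[ℂ] ℂ) (a b : A) : rapp φ (a ⊗ₜ[ℂ] b) = φ b • a := by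
  simp [rapp]

/-- A functional applied to the first leg of a threefold tensor. -/
def lappTriple (φ : A →ₗ[ℂ] ℂ) : A ⊗[ℂ] (A ⊗[ℂ] A) →ₗ[ℂ] A ⊗[ℂ] A :=
  (TensorProduct.lid ℂ (A ⊗[ℂ] A)).toLinearMap ∘ₗ TensorProduct.map φ LinearMap.id

/-- A functional applied to the last leg of a threefold tensor. -/
def rappTriple (φ : A →ₗ[ℂ] ℂ) : (A ⊗[ℂ] A) ⊗[ℂ] A →ₗ[ℂ] A ⊗[ℂ] A :=
  (TensorProduct.rid ℂ (A ⊗[ℂ] A)).toLinearMap ∘ₗ TensorProduct.map LinearMap.id φ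

@[simp] lemma lappTriple_tmul (φ : A →ₗ[ℂ] ℂ) (a : A) (t : A ⊗[ℂ] A) :
    lappTriple φ (a ⊗ₜ[ℂ] t) = φ a • t := by
  simp [lappTriple]

@[simp] lemma rappTriple_tmul (φ : A →ₗ[ℂ] ℂ) (t : A ⊗[ℂ] A) (b : A) :
    rappTriple φ (t ⊗ₜ[ℂ] b) = φ b • t := by
  simp [rappTriple]

/-- Induction on tensors, with the zero tensor treated as a pure tensor. -/
lemma tensor_induction {p : A ⊗[ℂ] A → Prop} (u : A ⊗[ℂ] A)
    (tmul : ∀ a b, p (a ⊗ₜ[ℂ] b)) (add : ∀ u v, p u → p v → p (u + v)) : p u := by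
  induction u using TensorProduct.induction_on with
  | zero => simpa using tmul 0 0
  | tmul a b => exact tmul a b
  | add u v hu hv => exact add u v hu hv

lemma lapp_mul_tmul_one (φ : A →ₗ[ℂ] ℂ) (a : A) (u : A ⊗[ℂ] A) :
    lapp φ (u * (a ⊗ₜ[ℂ] 1)) = lapp (φ ∘ₗ LinearMap.mulRight ℂ a) u := by
  induction u using tensor_induction with
  | tmul x y => simp
  | add u v hu hv => simp only [add_mul, map_add, hu, hv]

lemma lapp_tmul_one_mul (φ : A →ₗ[ℂ] ℂ) (a : A) (u : A ⊗[ℂ] A) :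
    lapp φ ((a ⊗ₜ[ℂ] 1) * u) = lapp (φ ∘ₗ LinearMap.mulLeft ℂ a) u := by
  induction u using tensor_induction with
  | tmul x y => simp
  | add u v hu hv => simp only [mul_add, map_add, hu, hv]

lemma lapp_one_tmul_mul (φ : A →ₗ[ℂ] ℂ) (a : A) (u : A ⊗[ℂ] A) :
    lapp φ ((1 ⊗ₜ[ℂ] a) * u) = a * lapp φ u := by
  induction u using tensor_induction with
  | tmul x y => simp
  | add u v hu hv => simp only [mul_add, map_add, hu, hv]

lemma rapp_one_tmul_mul (φ : A →ₗ[ℂ] ℂ) (a : A) (u : A ⊗[ℂ] A) :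
    rapp φ ((1 ⊗ₜ[ℂ] a) * u) = rapp (φ ∘ₗ LinearMap.mulLeft ℂ a) u := by
  induction u using tensor_induction with
  | tmul x y => simp
  | add u v hu hv => simp only [mul_add, map_add, hu, hv]

lemma rapp_tmul_one_mul (φ : A →ₗ[ℂ] ℂ) (a : A) (u : A ⊗[ℂ] A) :
    rapp φ ((a ⊗ₜ[ℂ] 1) * u) = a * rapp φ u := by
  induction u using tensor_induction with
  | tmul x y => simp
  | add u v hu hv => simp only [mul_add, map_add, hu, hv]

/-- Contracting both legs of a tensor does not depend on the order. -/
lemma apply_lapp (φ ψ : A →ₗ[ℂ] ℂ) (u : A ⊗[ℂ] A) : φ (lapp ψ u) = ψ (rapp φ u) := by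
  induction u using tensor_induction with
  | tmul x y => simp [mul_comm]
  | add u v hu hv => simp only [map_add, hu, hv]

lemma lapp_rappTriple (φ ψ : A →ₗ[ℂ] ℂ) (w : (A ⊗[ℂ] A) ⊗[ℂ] A) :
    lapp ψ (rappTriple φ w) = rapp φ (lappTriple ψ (TensorProduct.assoc ℂ A A A w)) := by
  induction w using TensorProduct.induction_on with
  | zero => simp
  | tmul t c =>
    induction t using tensor_induction with
    | tmul a b => simp [smul_smul, mul_comm]
    | add u v hu hv => simp only [TensorProduct.add_tmul, map_add, hu, hv]
  | add u v hu hv => simp only [map_add, hu, hv]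

lemma lappTriple_mul_assoc (ψ : A →ₗ[ℂ] ℂ) (u v : A ⊗[ℂ] A) :
    lappTriple ψ (TensorProduct.assoc ℂ A A A
      ((u ⊗ₜ[ℂ] (1 : A)) * (TensorProduct.assoc ℂ A A A).symm ((1 : A) ⊗ₜ[ℂ] v)))
      = (lapp ψ u ⊗ₜ[ℂ] 1) * v := by
  induction v using tensor_induction with
  | tmul c d =>
    induction u using tensor_induction with
    | tmul a b => simp [TensorProduct.smul_tmul']
    | add u v hu hv => simp only [TensorProduct.add_tmul, add_mul, map_add, hu, hv]
  | add u v hu hv => simp only [TensorProduct.tmul_add, mul_add, map_add, hu, hv]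

lemma lappTriple_assoc_mul (ψ : A →ₗ[ℂ] ℂ) (u v : A ⊗[ℂ] A) :
    lappTriple ψ (TensorProduct.assoc ℂ A A A
      ((TensorProduct.assoc ℂ A A A).symm ((1 : A) ⊗ₜ[ℂ] v) * (u ⊗ₜ[ℂ] (1 : A))))
      = v * (lapp ψ u ⊗ₜ[ℂ] 1) := by
  induction v using tensor_induction with
  | tmul c d =>
    induction u using tensor_induction with
    | tmul a b => simp [TensorProduct.smul_tmul']
    | add u v hu hv => simp only [TensorProduct.add_tmul, mul_add, map_add, hu, hv]
  | add u v hu hv => simp only [TensorProduct.tmul_add, add_mul, map_add, hu, hv]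

lemma rappTriple_mul_assoc (φ : A →ₗ[ℂ] ℂ) (u v : A ⊗[ℂ] A) :
    rappTriple φ ((u ⊗ₜ[ℂ] (1 : A)) * (TensorProduct.assoc ℂ A A A).symm ((1 : A) ⊗ₜ[ℂ] v))
      = u * (1 ⊗ₜ[ℂ] rapp φ v) := by
  induction v using tensor_induction with
  | tmul c d => simp [TensorProduct.tmul_smul]
  | add u v hu hv => simp only [TensorProduct.tmul_add, mul_add, map_add, hu, hv]

lemma rappTriple_assoc_mul (φ : A →ₗ[ℂ] ℂ) (u v : A ⊗[ℂ] A) :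
    rappTriple φ ((TensorProduct.assoc ℂ A A A).symm ((1 : A) ⊗ₜ[ℂ] v) * (u ⊗ₜ[ℂ] (1 : A)))
      = (1 ⊗ₜ[ℂ] rapp φ v) * u := by
  induction v using tensor_induction with
  | tmul c d => simp [TensorProduct.tmul_smul]
  | add u v hu hv => simp only [TensorProduct.tmul_add, add_mul, map_add, hu, hv]

end Legs

namespace WeakHopfData

variable {A : Type*} [NormedRing A] [StarRing A] [CStarRing A]
  [NormedAlgebra ℂ A] [StarModule ℂ A] [FiniteDimensional ℂ A] (W : WeakHopfData A)

lemma map_id_Δ (x : A) : TensorProduct.map LinearMap.id W.Δ (W.Δ x)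
    = TensorProduct.assoc ℂ A A A (TensorProduct.map W.Δ LinearMap.id (W.Δ x)) :=
  (LinearMap.congr_fun W.coassoc x).symm

lemma Δ_lapp (ψ : A →ₗ[ℂ] ℂ) (u : A ⊗[ℂ] A) :
    W.Δ (lapp ψ u) = lappTriple ψ (TensorProduct.map LinearMap.id W.Δ u) := by
  induction u using tensor_induction with
  | tmul a b => simp
  | add u v hu hv => simp only [map_add, hu, hv]

lemma Δ_rapp (φ : A →ₗ[ℂ] ℂ) (u : A ⊗[ℂ] A) :
    W.Δ (rapp φ u) = rappTriple φ (TensorProduct.map W.Δ LinearMap.id u) := by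
  induction u using tensor_induction with
  | tmul a b => simp
  | add u v hu hv => simp only [map_add, hu, hv]

/-- Coassociativity: contractions of the outer legs of `Δ⁽²⁾ x` commute. -/
lemma lapp_Δ_rapp_Δ (φ ψ : A →ₗ[ℂ] ℂ) (x : A) :
    lapp ψ (W.Δ (rapp φ (W.Δ x))) = rapp φ (W.Δ (lapp ψ (W.Δ x))) := by
  rw [Δ_rapp, Δ_lapp, map_id_Δ, lapp_rappTriple]

@[simp] lemma lapp_ε_Δ (x : A) : lapp W.ε (W.Δ x) = x :=
  LinearMap.congr_fun W.counit_left x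

@[simp] lemma rapp_ε_Δ (x : A) : rapp W.ε (W.Δ x) = x :=
  LinearMap.congr_fun W.counit_right x

lemma Δ_injective : Function.Injective W.Δ :=
  Function.LeftInverse.injective W.lapp_ε_Δ

@[simp] lemma Δ_mul_Δ_one (x : A) : W.Δ x * W.Δ 1 = W.Δ x := by rw [← W.Δ_mul, mul_one]

@[simp] lemma Δ_one_mul_Δ (x : A) : W.Δ 1 * W.Δ x = W.Δ x := by rw [← W.Δ_mul, one_mul]

@[simp] lemma S_one : W.S 1 = 1 := by
  obtain ⟨y, hy⟩ := W.S.surjective 1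
  have := W.S_antimul 1 y
  rw [one_mul, hy, one_mul] at this
  exact this.symm

/-- The elements of `A^L`, characterized by `Δ a = (a ⊗ 1) Δ 1 = Δ 1 (a ⊗ 1)`. -/
def IsLeft (a : A) : Prop :=
  W.Δ a = (a ⊗ₜ[ℂ] 1) * W.Δ 1 ∧ W.Δ a = W.Δ 1 * (a ⊗ₜ[ℂ] 1)

/-- The elements of `A^R`, characterized by `Δ a = (1 ⊗ a) Δ 1 = Δ 1 (1 ⊗ a)`. -/
def IsRight (a : A) : Prop :=
  W.Δ a = (1 ⊗ₜ[ℂ] a) * W.Δ 1 ∧ W.Δ a = W.Δ 1 * (1 ⊗ₜ[ℂ] a)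

variable {W}

lemma IsLeft.Δ_mul_left {a : A} (ha : W.IsLeft a) (x : A) :
    W.Δ (a * x) = (a ⊗ₜ[ℂ] 1) * W.Δ x := by
  rw [W.Δ_mul, ha.1, mul_assoc, Δ_one_mul_Δ]

lemma IsLeft.Δ_mul_right {a : A} (ha : W.IsLeft a) (x : A) :
    W.Δ (x * a) = W.Δ x * (a ⊗ₜ[ℂ] 1) := by
  rw [W.Δ_mul, ha.2, ← mul_assoc, Δ_mul_Δ_one]

lemma IsRight.Δ_mul_left {a : A} (ha : W.IsRight a) (x : A) :
    W.Δ (a * x) = (1 ⊗ₜ[ℂ] a) * W.Δ x := by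
  rw [W.Δ_mul, ha.1, mul_assoc, Δ_one_mul_Δ]

lemma IsRight.Δ_mul_right {a : A} (ha : W.IsRight a) (x : A) :
    W.Δ (x * a) = W.Δ x * (1 ⊗ₜ[ℂ] a) := by
  rw [W.Δ_mul, ha.2, ← mul_assoc, Δ_mul_Δ_one]

lemma IsLeft.mul {a b : A} (ha : W.IsLeft a) (hb : W.IsLeft b) : W.IsLeft (a * b) := by
  constructor
  · rw [ha.Δ_mul_left, hb.1, ← mul_assoc]; simp
  · rw [hb.Δ_mul_right, ha.2, mul_assoc]; simp

lemma IsRight.mul {a b : A} (ha : W.IsRight a) (hb : W.IsRight b) : W.IsRight (a * b) := by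
  constructor
  · rw [ha.Δ_mul_left, hb.1, ← mul_assoc]; simp
  · rw [hb.Δ_mul_right, ha.2, mul_assoc]; simp

lemma IsLeft.of_mul_eq_one {a b : A} (ha : W.IsLeft a) (hab : a * b = 1) (hba : b * a = 1) :
    W.IsLeft b := by
  constructor
  · have h := ha.Δ_mul_left b
    rw [hab] at h
    rw [h, ← mul_assoc]
    simp [hba, ← Algebra.TensorProduct.one_def]
  · have h := ha.Δ_mul_right b
    rw [hba] at h
    rw [h, mul_assoc]
    simp [hab, ← Algebra.TensorProduct.one_def]

lemma IsRight.of_mul_eq_one {a b : A} (ha : W.IsRight a) (hab : a * b = 1) (hba : b * a = 1) :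
    W.IsRight b := by
  constructor
  · have h := ha.Δ_mul_left b
    rw [hab] at h
    rw [h, ← mul_assoc]
    simp [hba, ← Algebra.TensorProduct.one_def]
  · have h := ha.Δ_mul_right b
    rw [hba] at h
    rw [h, mul_assoc]
    simp [hab, ← Algebra.TensorProduct.one_def]

lemma IsLeft.commute {a b : A} (ha : W.IsLeft a) (hb : W.IsRight b) : Commute a b := by
  apply W.Δ_injective
  rw [ha.Δ_mul_left, hb.Δ_mul_left, ha.1, hb.1, ← mul_assoc, ← mul_assoc]
  simp

variable (W)

lemma isLeft_lapp_Δ_one (ψ : A →ₗ[ℂ] ℂ) : W.IsLeft (lapp ψ (W.Δ 1)) := by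
  constructor
  · rw [Δ_lapp, map_id_Δ, W.Δ_one_weak, lappTriple_mul_assoc]
  · rw [Δ_lapp, map_id_Δ, W.Δ_one_weak', lappTriple_assoc_mul]

lemma isRight_rapp_Δ_one (φ : A →ₗ[ℂ] ℂ) : W.IsRight (rapp φ (W.Δ 1)) := by
  constructor
  · rw [Δ_rapp, W.Δ_one_weak', rappTriple_assoc_mul]
  · rw [Δ_rapp, W.Δ_one_weak, rappTriple_mul_assoc]

lemma εL_eq_lapp (x : A) : W.εL x = lapp (W.ε ∘ₗ LinearMap.mulRight ℂ x) (W.Δ 1) :=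
  W.antipode_left x

lemma εR_eq_rapp (x : A) : W.εR x = rapp (W.ε ∘ₗ LinearMap.mulLeft ℂ x) (W.Δ 1) :=
  W.antipode_right x

lemma isLeft_εL (x : A) : W.IsLeft (W.εL x) := W.εL_eq_lapp x ▸ W.isLeft_lapp_Δ_one _

lemma isRight_εR (x : A) : W.IsRight (W.εR x) := W.εR_eq_rapp x ▸ W.isRight_rapp_Δ_one _

lemma mul'_map_id_S_tmul_one_mul (a : A) (u : A ⊗[ℂ] A) :
    LinearMap.mul' ℂ A (TensorProduct.map LinearMap.id W.S.toLinearMap ((a ⊗ₜ[ℂ] 1) * u))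
      = a * LinearMap.mul' ℂ A (TensorProduct.map LinearMap.id W.S.toLinearMap u) := by
  induction u using tensor_induction with
  | tmul x y => simp [mul_assoc]
  | add u v hu hv => simp only [mul_add, map_add, hu, hv]

lemma mul'_map_id_S_one_tmul_mul (a : A) (u : A ⊗[ℂ] A) :
    LinearMap.mul' ℂ A (TensorProduct.map LinearMap.id W.S.toLinearMap ((1 ⊗ₜ[ℂ] a) * u))
      = LinearMap.mul' ℂ A (TensorProduct.map LinearMap.id W.S.toLinearMap u) * W.S a := by
  induction u using tensor_induction with
  | tmul x y => simp [mul_assoc, W.S_antimul]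
  | add u v hu hv => simp only [mul_add, add_mul, map_add, hu, hv]

lemma mul'_map_S_id_mul_one_tmul (a : A) (u : A ⊗[ℂ] A) :
    LinearMap.mul' ℂ A (TensorProduct.map W.S.toLinearMap LinearMap.id (u * (1 ⊗ₜ[ℂ] a)))
      = LinearMap.mul' ℂ A (TensorProduct.map W.S.toLinearMap LinearMap.id u) * a := by
  induction u using tensor_induction with
  | tmul x y => simp [mul_assoc]
  | add u v hu hv => simp only [add_mul, map_add, hu, hv]

lemma mul'_map_S_id_mul_tmul_one (a : A) (u : A ⊗[ℂ] A) :
    LinearMap.mul' ℂ A (TensorProduct.map W.S.toLinearMap LinearMap.id (u * (a ⊗ₜ[ℂ] 1)))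
      = W.S a * LinearMap.mul' ℂ A (TensorProduct.map W.S.toLinearMap LinearMap.id u) := by
  induction u using tensor_induction with
  | tmul x y => simp [mul_assoc, W.S_antimul]
  | add u v hu hv => simp only [add_mul, mul_add, map_add, hu, hv]

@[simp] lemma εL_one : W.εL 1 = 1 := by
  rw [εL_eq_lapp, LinearMap.mulRight_one, LinearMap.comp_id, lapp_ε_Δ]

@[simp] lemma εR_one : W.εR 1 = 1 := by
  rw [εR_eq_rapp, LinearMap.mulLeft_one, LinearMap.comp_id, rapp_ε_Δ]

variable {W}

lemma IsLeft.εL_eq {a : A} (ha : W.IsLeft a) : W.εL a = a := by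
  have h := W.mul'_map_id_S_tmul_one_mul a (W.Δ 1)
  rw [← ha.1] at h
  calc W.εL a = a * W.εL 1 := h
    _ = a := by rw [εL_one, mul_one]

lemma IsRight.εR_eq {a : A} (ha : W.IsRight a) : W.εR a = a := by
  have h := W.mul'_map_S_id_mul_one_tmul a (W.Δ 1)
  rw [← ha.2] at h
  calc W.εR a = W.εR 1 * a := h
    _ = a := by rw [εR_one, one_mul]

lemma IsLeft.εR_eq {a : A} (ha : W.IsLeft a) : W.εR a = W.S a := by
  have h := W.mul'_map_S_id_mul_tmul_one a (W.Δ 1)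
  rw [← ha.2] at h
  calc W.εR a = W.S a * W.εR 1 := h
    _ = W.S a := by rw [εR_one, mul_one]

/-- The antipode fixes `A^L ∩ A^R` pointwise. -/
lemma IsLeft.S_eq_self {a : A} (ha : W.IsLeft a) (ha' : W.IsRight a) : W.S a = a := by
  rw [← ha.εR_eq, ha'.εR_eq]

variable (W)

/-- `ε^R(x₍₁₎) ⊗ x₍₂₎ = 1₍₁₎ ⊗ x 1₍₂₎`. -/
lemma map_εR_id_Δ (x : A) :
    TensorProduct.map W.εR LinearMap.id (W.Δ x) = (1 ⊗ₜ[ℂ] x) * W.Δ 1 := by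
  have expand (u : A ⊗[ℂ] A) : (1 ⊗ₜ[ℂ] x) * u
      = TensorProduct.map LinearMap.id (lapp W.ε ∘ₗ LinearMap.mulLeft ℂ (W.Δ x))
        (TensorProduct.map LinearMap.id W.Δ u) := by
    induction u using tensor_induction with
    | tmul a b => simp [← W.Δ_mul]
    | add u v hu hv => simp only [mul_add, map_add, hu, hv]
  have absorb (u v : A ⊗[ℂ] A) :
      TensorProduct.map LinearMap.id (lapp W.ε ∘ₗ LinearMap.mulLeft ℂ (W.Δ x))
        (TensorProduct.assoc ℂ A A A
          ((TensorProduct.assoc ℂ A A A).symm ((1 : A) ⊗ₜ[ℂ] v) * (u ⊗ₜ[ℂ] (1 : A))))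
      = TensorProduct.map LinearMap.id (lapp W.ε ∘ₗ LinearMap.mulLeft ℂ (W.Δ x * v) ∘ₗ
          (TensorProduct.mk ℂ A A).flip 1) u := by
    induction u using tensor_induction with
    | tmul a b =>
      induction v using tensor_induction with
      | tmul c d => simp
      | add u v hu hv =>
        simp only [TensorProduct.tmul_add, add_mul, map_add, hu, hv]
        simp [mul_add, add_mul, TensorProduct.tmul_add, mul_assoc]
    | add u v hu hv => simp only [TensorProduct.add_tmul, mul_add, map_add, hu, hv]
  have pure (a b : A) (u : A ⊗[ℂ] A) :
      TensorProduct.map LinearMap.id (lapp W.ε ∘ₗ LinearMap.mulLeft ℂ (a ⊗ₜ[ℂ] b) ∘ₗ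
          (TensorProduct.mk ℂ A A).flip 1) u
      = rapp (W.ε ∘ₗ LinearMap.mulLeft ℂ a) u ⊗ₜ[ℂ] b := by
    induction u using tensor_induction with
    | tmul c d => simp [TensorProduct.smul_tmul']
    | add u v hu hv => simp only [TensorProduct.add_tmul, map_add, hu, hv]
  have contract (t : A ⊗[ℂ] A) :
      TensorProduct.map LinearMap.id (lapp W.ε ∘ₗ LinearMap.mulLeft ℂ t ∘ₗ
          (TensorProduct.mk ℂ A A).flip 1) (W.Δ 1)
      = TensorProduct.map W.εR LinearMap.id t := by
    induction t using tensor_induction with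
    | tmul a b => rw [pure, TensorProduct.map_tmul, εR_eq_rapp, LinearMap.id_apply]
    | add u v hu hv =>
      have h : LinearMap.mulLeft ℂ (u + v) = LinearMap.mulLeft ℂ u + LinearMap.mulLeft ℂ v :=
        map_add (LinearMap.mul ℂ (A ⊗[ℂ] A)) u v
      rw [h, LinearMap.add_comp, LinearMap.comp_add, TensorProduct.map_add_right,
        LinearMap.add_apply, hu, hv, map_add]
  rw [expand, map_id_Δ, W.Δ_one_weak', absorb, Δ_mul_Δ_one, contract]

/-- `ε^R(x₍₁₎) S(x₍₂₎) = S(x)`. -/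
lemma mul'_map_εR_S_Δ (x : A) :
    LinearMap.mul' ℂ A (TensorProduct.map W.εR W.S.toLinearMap (W.Δ x)) = W.S x := by
  have split (u : A ⊗[ℂ] A) : TensorProduct.map W.εR W.S.toLinearMap u
      = TensorProduct.map LinearMap.id W.S.toLinearMap
        (TensorProduct.map W.εR LinearMap.id u) := by
    induction u using tensor_induction with
    | tmul a b => simp
    | add u v hu hv => simp only [map_add, hu, hv]
  rw [split, map_εR_id_Δ, mul'_map_id_S_one_tmul_mul]
  calc W.εL 1 * W.S x = W.S x := by rw [εL_one, one_mul]

/-- `S(x₍₁₎) ε^L(x₍₂₎) = S(x)`. -/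
lemma mul'_map_S_εL_Δ (x : A) :
    LinearMap.mul' ℂ A (TensorProduct.map W.S.toLinearMap W.εL (W.Δ x)) = W.S x := by
  have regroup (w : (A ⊗[ℂ] A) ⊗[ℂ] A) :
      LinearMap.mul' ℂ A (TensorProduct.map W.S.toLinearMap (LinearMap.mul' ℂ A ∘ₗ
        TensorProduct.map LinearMap.id W.S.toLinearMap) (TensorProduct.assoc ℂ A A A w))
      = LinearMap.mul' ℂ A (TensorProduct.map (LinearMap.mul' ℂ A ∘ₗ
        TensorProduct.map W.S.toLinearMap LinearMap.id) W.S.toLinearMap w) := by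
    induction w using TensorProduct.induction_on with
    | zero => simp
    | tmul t c =>
      induction t using tensor_induction with
      | tmul a b => simp [mul_assoc]
      | add u v hu hv => simp only [TensorProduct.add_tmul, map_add, hu, hv]
    | add u v hu hv => simp only [map_add, hu, hv]
  have left (u : A ⊗[ℂ] A) : TensorProduct.map W.S.toLinearMap W.εL u
      = TensorProduct.map W.S.toLinearMap (LinearMap.mul' ℂ A ∘ₗ
        TensorProduct.map LinearMap.id W.S.toLinearMap)
        (TensorProduct.map LinearMap.id W.Δ u) := by
    induction u using tensor_induction with
    | tmul a b => simp [εL]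
    | add u v hu hv => simp only [map_add, hu, hv]
  have right (u : A ⊗[ℂ] A) : TensorProduct.map (LinearMap.mul' ℂ A ∘ₗ
        TensorProduct.map W.S.toLinearMap LinearMap.id) W.S.toLinearMap
        (TensorProduct.map W.Δ LinearMap.id u)
      = TensorProduct.map W.εR W.S.toLinearMap u := by
    induction u using tensor_induction with
    | tmul a b => simp [εR]
    | add u v hu hv => simp only [map_add, hu, hv]
  rw [left, map_id_Δ, regroup, right, mul'_map_εR_S_Δ]

/-- For a left integral `h`, one has `S(x) h₍₁₎ ⊗ h₍₂₎ = h₍₁₎ ⊗ x h₍₂₎`. -/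
lemma S_tmul_one_mul_Δ {h : A} (hh : ∀ x, x * h = W.εL x * h) (x : A) :
    (W.S x ⊗ₜ[ℂ] 1) * W.Δ h = (1 ⊗ₜ[ℂ] x) * W.Δ h := by
  have regroup (w : (A ⊗[ℂ] A) ⊗[ℂ] A) :
      LinearMap.mul' ℂ (A ⊗[ℂ] A) (TensorProduct.map ((TensorProduct.mk ℂ A A).flip 1 ∘ₗ
        W.S.toLinearMap) LinearMap.id (TensorProduct.assoc ℂ A A A w))
      = TensorProduct.map (LinearMap.mul' ℂ A ∘ₗ
        TensorProduct.map W.S.toLinearMap LinearMap.id) LinearMap.id w := by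
    induction w using TensorProduct.induction_on with
    | zero => simp
    | tmul t c =>
      induction t using tensor_induction with
      | tmul a b => simp
      | add u v hu hv => simp only [TensorProduct.add_tmul, map_add, hu, hv]
    | add u v hu hv => simp only [map_add, hu, hv]
  have right (u : A ⊗[ℂ] A) : TensorProduct.map (LinearMap.mul' ℂ A ∘ₗ
        TensorProduct.map W.S.toLinearMap LinearMap.id) LinearMap.id
        (TensorProduct.map W.Δ LinearMap.id u)
      = TensorProduct.map W.εR LinearMap.id u := by
    induction u using tensor_induction with
    | tmul a b => simp [εR]
    | add u v hu hv => simp only [map_add, hu, hv]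
  have left (u : A ⊗[ℂ] A) :
      LinearMap.mul' ℂ (A ⊗[ℂ] A) (TensorProduct.map ((TensorProduct.mk ℂ A A).flip 1 ∘ₗ
        W.S.toLinearMap) LinearMap.id (TensorProduct.map LinearMap.id W.Δ u)) * W.Δ h
      = (LinearMap.mul' ℂ A (TensorProduct.map W.S.toLinearMap W.εL u) ⊗ₜ[ℂ] 1) * W.Δ h := by
    induction u using tensor_induction with
    | tmul a b =>
      have hb : W.Δ b * W.Δ h = (W.εL b ⊗ₜ[ℂ] 1) * W.Δ h := by
        rw [← W.Δ_mul, hh, (W.isLeft_εL b).Δ_mul_left]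
      simp [mul_assoc, hb]
      simp [← mul_assoc]
    | add u v hu hv => simp only [TensorProduct.add_tmul, add_mul, map_add, hu, hv]
  calc (W.S x ⊗ₜ[ℂ] 1) * W.Δ h = _ := by rw [← mul'_map_S_εL_Δ]
    _ = _ := (left _).symm
    _ = (1 ⊗ₜ[ℂ] x) * W.Δ h := by
      rw [map_id_Δ, regroup, right, map_εR_id_Δ, mul_assoc, Δ_one_mul_Δ]

lemma lapp_Δ_S (φ : A →ₗ[ℂ] ℂ) (x : A) :
    lapp φ (W.Δ (W.S x)) = W.S (rapp (φ ∘ₗ W.S.toLinearMap) (W.Δ x)) := by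
  have h (u : A ⊗[ℂ] A) : lapp φ ((TensorProduct.comm ℂ A A)
      ((TensorProduct.map W.S.toLinearMap W.S.toLinearMap) u))
      = W.S (rapp (φ ∘ₗ W.S.toLinearMap) u) := by
    induction u using tensor_induction with
    | tmul a b => simp
    | add u v hu hv => simp only [map_add, hu, hv]
  rw [W.S_anticomul, h]

lemma rapp_Δ_S (φ : A →ₗ[ℂ] ℂ) (x : A) :
    rapp φ (W.Δ (W.S x)) = W.S (lapp (φ ∘ₗ W.S.toLinearMap) (W.Δ x)) := by
  have h (u : A ⊗[ℂ] A) : rapp φ ((TensorProduct.comm ℂ A A)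
      ((TensorProduct.map W.S.toLinearMap W.S.toLinearMap) u))
      = W.S (lapp (φ ∘ₗ W.S.toLinearMap) u) := by
    induction u using tensor_induction with
    | tmul a b => simp
    | add u v hu hv => simp only [map_add, hu, hv]
  rw [W.S_anticomul, h]

lemma starT_mul (u v : A ⊗[ℂ] A) : W.starT (u * v) = W.starT v * W.starT u := by
  induction u using tensor_induction with
  | tmul a b =>
    induction v using tensor_induction with
    | tmul c d => simp [W.starT_tmul]
    | add u v hu hv => simp only [mul_add, add_mul, W.starT_add, hu, hv]
  | add u v hu hv => simp only [mul_add, add_mul, W.starT_add, hu, hv]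

lemma starT_sum {ι : Type*} (s : Finset ι) (u : ι → A ⊗[ℂ] A) :
    W.starT (∑ i ∈ s, u i) = ∑ i ∈ s, W.starT (u i) :=
  map_sum (AddMonoidHom.mk' W.starT W.starT_add) u s

lemma Δ_star_one : W.starT (W.Δ 1) = W.Δ 1 := by
  rw [← W.Δ_star, star_one]

variable {W}

lemma IsRight.star {a : A} (ha : W.IsRight a) : W.IsRight (star a) := by
  constructor
  · rw [W.Δ_star, ha.2, starT_mul, Δ_star_one, W.starT_tmul, star_one]
  · rw [W.Δ_star, ha.1, starT_mul, Δ_star_one, W.starT_tmul, star_one]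

end WeakHopfData

namespace HaarPkg

variable {A : Type*} [NormedRing A] [StarRing A] [CStarRing A]
  [NormedAlgebra ℂ A] [StarModule ℂ A] [FiniteDimensional ℂ A] (P : HaarPkg A)

@[simp] lemma gL_mul_inverse : P.gL * Ring.inverse P.gL = 1 := Ring.mul_inverse_cancel _ P.gL_unit

@[simp] lemma inverse_mul_gL : Ring.inverse P.gL * P.gL = 1 := Ring.inverse_mul_cancel _ P.gL_unit

@[simp] lemma gR_mul_inverse : P.gR * Ring.inverse P.gR = 1 := Ring.mul_inverse_cancel _ P.gR_unit

@[simp] lemma inverse_mul_gR : Ring.inverse P.gR * P.gR = 1 := Ring.inverse_mul_cancel _ P.gR_unit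

lemma S_inverse_gL : P.W.S (Ring.inverse P.gL) = Ring.inverse P.gR := by
  have h : P.gR * P.W.S (Ring.inverse P.gL) = 1 := by
    rw [P.gR_S, ← P.W.S_antimul, inverse_mul_gL, WeakHopfData.S_one]
  rw [← one_mul (P.W.S _), ← P.inverse_mul_gR, mul_assoc, h, mul_one]

lemma isLeft_gL : P.W.IsLeft P.gL := by
  obtain ⟨x, hx⟩ := P.gL_mem
  exact hx ▸ P.W.isLeft_εL x

lemma isRight_gR : P.W.IsRight P.gR := by
  obtain ⟨x, hx⟩ := P.gR_mem
  exact hx ▸ P.W.isRight_εR x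

lemma isLeft_inverse_gL : P.W.IsLeft (Ring.inverse P.gL) :=
  P.isLeft_gL.of_mul_eq_one P.gL_mul_inverse P.inverse_mul_gL

lemma isRight_inverse_gR : P.W.IsRight (Ring.inverse P.gR) :=
  P.isRight_gR.of_mul_eq_one P.gR_mul_inverse P.inverse_mul_gR

lemma commute_gL_gR : Commute P.gL P.gR := P.gLR_comm

lemma commute_gL_inverse_gR : Commute P.gL (Ring.inverse P.gR) :=
  P.isLeft_gL.commute P.isRight_inverse_gR

lemma inverse_g : Ring.inverse (P.gL * Ring.inverse P.gR) = P.gR * Ring.inverse P.gL := by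
  have h : (P.gL * Ring.inverse P.gR) * (P.gR * Ring.inverse P.gL) = 1 := by
    rw [mul_assoc, ← mul_assoc _ P.gR, inverse_mul_gR, one_mul, gL_mul_inverse]
  calc _ = Ring.inverse (P.gL * Ring.inverse P.gR) *
        ((P.gL * Ring.inverse P.gR) * (P.gR * Ring.inverse P.gL)) := by rw [h, mul_one]
    _ = _ := by rw [← mul_assoc, Ring.inverse_mul_cancel _ P.g_unit, one_mul]

lemma S_gR : P.W.S P.gR = P.gL := by
  rw [P.gR_S, P.S_sq, inverse_g]
  calc P.gL * Ring.inverse P.gR * P.gL * (P.gR * Ring.inverse P.gL)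
      = P.gL * (Ring.inverse P.gR * P.gL) * (P.gR * Ring.inverse P.gL) := by
        simp only [mul_assoc]
    _ = P.gL * (P.gL * ((Ring.inverse P.gR * P.gR) * Ring.inverse P.gL)) := by
        rw [← P.commute_gL_inverse_gR.eq]; simp only [mul_assoc]
    _ = P.gL := by rw [inverse_mul_gR, one_mul, gL_mul_inverse, mul_one]

lemma S_inverse_gR : P.W.S (Ring.inverse P.gR) = Ring.inverse P.gL := by
  have h : P.gL * P.W.S (Ring.inverse P.gR) = 1 := by
    rw [← P.S_gR, ← P.W.S_antimul, inverse_mul_gR, WeakHopfData.S_one]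
  rw [← one_mul (P.W.S _), ← P.inverse_mul_gL, mul_assoc, h, mul_one]

@[simp] lemma hHat_comp_S : P.hHat ∘ₗ P.W.S.toLinearMap = P.hHat :=
  LinearMap.ext P.hHat_S

/-- `E^R(x) = ⟨ĥ, x₍₁₎⟩ x₍₂₎` lies in `A^R`. -/
lemma isRight_lapp_hHat (x : A) : P.W.IsRight (lapp P.hHat (P.W.Δ x)) := by
  obtain ⟨-, φ, -, rfl⟩ := P.haar_nondeg x
  rw [P.W.lapp_Δ_rapp_Δ, ← P.gR_sq, (P.isRight_gR.mul P.isRight_gR).1, rapp_one_tmul_mul]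
  exact P.W.isRight_rapp_Δ_one _

/-- A functional is determined by its contraction with the second leg of `Δ h`. -/
lemma eq_of_rapp_Δ_h {φ ψ : A →ₗ[ℂ] ℂ} (H : rapp φ (P.W.Δ P.h) = rapp ψ (P.W.Δ P.h)) :
    φ = ψ := by
  ext x
  obtain ⟨χ, -, rfl, -⟩ := P.haar_nondeg x
  rw [apply_lapp, apply_lapp, H]

/-- `⟨ĥ, x h₍₂₎⟩ h₍₁₎ = S(x) g_L²`. -/
lemma rapp_hHat_mulLeft (x : A) :
    rapp (P.hHat ∘ₗ LinearMap.mulLeft ℂ x) (P.W.Δ P.h) = P.W.S x * (P.gL * P.gL) := by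
  rw [← rapp_one_tmul_mul, ← P.W.S_tmul_one_mul_Δ P.haar_left, rapp_tmul_one_mul, P.gL_sq]

/-- `⟨ĥ, h₍₁₎ x⟩ h₍₂₎ = g_R² S(x)`. -/
lemma lapp_hHat_mulRight (x : A) :
    lapp (P.hHat ∘ₗ LinearMap.mulRight ℂ x) (P.W.Δ P.h) = P.gR * P.gR * P.W.S x := by
  have h : (P.hHat ∘ₗ LinearMap.mulRight ℂ x) ∘ₗ P.W.S.toLinearMap
      = P.hHat ∘ₗ LinearMap.mulLeft ℂ (P.W.S.symm x) := by
    ext y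
    simp only [LinearMap.comp_apply, LinearMap.mulRight_apply, LinearMap.mulLeft_apply,
      LinearEquiv.coe_coe]
    rw [← P.hHat_S (P.W.S.symm x * y), P.W.S_antimul, LinearEquiv.apply_symm_apply]
  nth_rewrite 1 [← P.haar_S]
  rw [P.W.lapp_Δ_S, h, rapp_hHat_mulLeft, LinearEquiv.apply_symm_apply, P.W.S_antimul,
    P.W.S_antimul, ← P.gR_S]

/-- The modular property of the Haar functional. -/
lemma hHat_mul (x y : A) : P.hHat (x * y) = P.hHat (P.gL * Ring.inverse P.gR * y *
    (P.gL * Ring.inverse P.gR) * (P.gR * P.gR * x * (Ring.inverse P.gL * Ring.inverse P.gL))) := by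
  set g := P.gL * Ring.inverse P.gR with hg
  set w := P.gR * P.gR * x * (Ring.inverse P.gL * Ring.inverse P.gL) with hw
  have flip (u : A ⊗[ℂ] A) (φ : A →ₗ[ℂ] ℂ) : rapp (φ ∘ₗ LinearMap.mulLeft ℂ g ∘ₗ
      LinearMap.mulRight ℂ g) u
      = rapp φ (TensorProduct.map LinearMap.id
        (LinearMap.mulLeft ℂ g ∘ₗ LinearMap.mulRight ℂ g) u) := by
    induction u using tensor_induction with
    | tmul a b => simp
    | add u v hu hv => simp only [map_add, hu, hv]
  have comm (u : A ⊗[ℂ] A) (φ : A →ₗ[ℂ] ℂ) :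
      rapp φ (TensorProduct.comm ℂ A A u) = lapp φ u := by
    induction u using tensor_induction with
    | tmul a b => simp
    | add u v hu hv => simp only [map_add, hu, hv]
  have Sw : P.gR * P.gR * P.W.S w = P.W.S x * (P.gL * P.gL) := by
    calc P.gR * P.gR * P.W.S w
        = P.gR * ((P.gR * Ring.inverse P.gR) * Ring.inverse P.gR) * P.W.S x * (P.gL * P.gL) := by
          simp only [hw, P.W.S_antimul, S_gR, S_inverse_gL, mul_assoc]
      _ = P.W.S x * (P.gL * P.gL) := by
          rw [gR_mul_inverse, one_mul, gR_mul_inverse, one_mul]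
  have key : P.hHat ∘ₗ LinearMap.mulLeft ℂ x
      = (P.hHat ∘ₗ LinearMap.mulRight ℂ w) ∘ₗ LinearMap.mulLeft ℂ g ∘ₗ
        LinearMap.mulRight ℂ g := by
    apply P.eq_of_rapp_Δ_h
    rw [flip, P.haar_flip, comm, lapp_hHat_mulRight, rapp_hHat_mulLeft, Sw]
  have := LinearMap.congr_fun key y
  simpa [mul_assoc] using this

/-- `⟨ĥ, g_L⁻² S(a) b⟩ = ⟨ĥ, g_R⁻² a S(b)⟩`. -/
lemma hHat_S_mul (a b : A) :
    P.hHat (Ring.inverse P.gL * Ring.inverse P.gL * (P.W.S a * b))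
      = P.hHat (Ring.inverse P.gR * Ring.inverse P.gR * (a * P.W.S b)) := by
  have h : P.gL * Ring.inverse P.gR *
      (P.gR * P.gR * (Ring.inverse P.gL * Ring.inverse P.gL)) = P.gR * Ring.inverse P.gL := by
    rw [← mul_assoc, mul_assoc P.gL, ← mul_assoc (Ring.inverse P.gR), P.inverse_mul_gR, one_mul,
      ← mul_assoc, P.commute_gL_gR.eq, mul_assoc P.gR, P.gL_mul_inverse, mul_one]
  calc _ = P.hHat (Ring.inverse P.gL * Ring.inverse P.gL * P.W.S a * b) := by simp only [mul_assoc]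
    _ = P.hHat (P.gL * Ring.inverse P.gR * b * (P.gL * Ring.inverse P.gR *
          (P.gR * P.gR * (Ring.inverse P.gL * Ring.inverse P.gL))) * P.W.S a *
          (Ring.inverse P.gL * Ring.inverse P.gL)) := by
        rw [hHat_mul]; simp only [mul_assoc]
    _ = P.hHat (P.W.S (P.W.S b) * P.W.S a * (Ring.inverse P.gL * Ring.inverse P.gL)) := by
        rw [h, P.S_sq, inverse_g]
    _ = P.hHat (P.W.S (Ring.inverse P.gR * Ring.inverse P.gR * (a * P.W.S b))) := by
        rw [P.W.S_antimul, P.W.S_antimul, P.W.S_antimul (Ring.inverse P.gR), S_inverse_gR]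
    _ = _ := P.hHat_S _

lemma isLeft_jayEl : P.W.IsLeft P.jayEl := by
  rw [jayEl, (P.isLeft_inverse_gL.mul P.isLeft_inverse_gL).1, lapp_tmul_one_mul]
  exact P.W.isLeft_lapp_Δ_one _

lemma isRight_jayEl : P.W.IsRight P.jayEl := P.isRight_lapp_hHat _

lemma S_jayEl : P.W.S P.jayEl = P.jayEl := P.isLeft_jayEl.S_eq_self P.isRight_jayEl

lemma jayEl_eq_rapp :
    P.jayEl = rapp P.hHat (P.W.Δ (Ring.inverse P.gR * Ring.inverse P.gR)) := by
  rw [← P.S_jayEl, ← P.S_inverse_gL, ← P.W.S_antimul, P.W.rapp_Δ_S, hHat_comp_S, jayEl]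

lemma ε_mul_jayEl (x : A) : P.W.ε (x * P.jayEl)
    = P.hHat (Ring.inverse P.gL * Ring.inverse P.gL * P.W.εR x) := by
  have h := apply_lapp (P.W.ε ∘ₗ LinearMap.mulLeft ℂ x)
    (P.hHat ∘ₗ LinearMap.mulLeft ℂ (Ring.inverse P.gL * Ring.inverse P.gL)) (P.W.Δ 1)
  rw [← lapp_tmul_one_mul, ← (P.isLeft_inverse_gL.mul P.isLeft_inverse_gL).1,
    ← WeakHopfData.εR_eq_rapp] at h
  exact h

lemma ε_jayEl_mul (x : A) : P.W.ε (P.jayEl * x)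
    = P.hHat (Ring.inverse P.gR * Ring.inverse P.gR * P.W.εL x) := by
  have h := apply_lapp (P.hHat ∘ₗ LinearMap.mulLeft ℂ (Ring.inverse P.gR * Ring.inverse P.gR))
    (P.W.ε ∘ₗ LinearMap.mulRight ℂ x) (P.W.Δ 1)
  rw [← rapp_one_tmul_mul, ← (P.isRight_inverse_gR.mul P.isRight_inverse_gR).1,
    ← WeakHopfData.εL_eq_lapp, ← jayEl_eq_rapp] at h
  exact h.symm

lemma ε_jayEl_mul_comm (x : A) : P.W.ε (P.jayEl * x) = P.W.ε (x * P.jayEl) := by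
  have h (u : A ⊗[ℂ] A) :
      P.hHat (Ring.inverse P.gL * Ring.inverse P.gL *
        LinearMap.mul' ℂ A (TensorProduct.map P.W.S.toLinearMap LinearMap.id u))
      = P.hHat (Ring.inverse P.gR * Ring.inverse P.gR *
        LinearMap.mul' ℂ A (TensorProduct.map LinearMap.id P.W.S.toLinearMap u)) := by
    induction u using tensor_induction with
    | tmul a b => simpa using P.hHat_S_mul a b
    | add u v hu hv => simp only [mul_add, map_add, hu, hv]
  rw [ε_mul_jayEl, ε_jayEl_mul]
  exact (h _).symm

lemma jayEl_commute (x : A) : Commute P.jayEl x := by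
  have h : P.W.ε ∘ₗ LinearMap.mulLeft ℂ P.jayEl = P.W.ε ∘ₗ LinearMap.mulRight ℂ P.jayEl :=
    LinearMap.ext P.ε_jayEl_mul_comm
  calc P.jayEl * x = lapp P.W.ε (P.W.Δ (P.jayEl * x)) := (P.W.lapp_ε_Δ _).symm
    _ = lapp P.W.ε (P.W.Δ (x * P.jayEl)) := by
      rw [P.isLeft_jayEl.Δ_mul_left, P.isLeft_jayEl.Δ_mul_right, lapp_tmul_one_mul,
        lapp_mul_tmul_one, h]
    _ = x * P.jayEl := P.W.lapp_ε_Δ _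

lemma isSelfAdjoint_gL : star P.gL = P.gL := by
  obtain ⟨y, hy⟩ := P.gL_pos
  rw [hy, star_mul, star_star]

lemma isSelfAdjoint_inverse_gL : star (Ring.inverse P.gL) = Ring.inverse P.gL := by
  have h : P.gL * star (Ring.inverse P.gL) = 1 := by
    nth_rewrite 1 [← P.isSelfAdjoint_gL]
    rw [← star_mul, inverse_mul_gL, star_one]
  rw [← one_mul (star _), ← P.inverse_mul_gL, mul_assoc, h, mul_one]

lemma hHat_star_mul_self_nonneg (x : A) :
    0 ≤ (P.hHat (star x * x)).re ∧ (P.hHat (star x * x)).im = 0 := by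
  obtain ⟨r, hr, h⟩ := P.hHat_pos x
  simp [h, hr]

lemma hHat_star (x : A) : P.hHat (star x) = star (P.hHat x) := by
  have h0 := (P.hHat_star_mul_self_nonneg 1).2
  have hx := (P.hHat_star_mul_self_nonneg x).2
  have h1 := (P.hHat_star_mul_self_nonneg (1 + x)).2
  have h2 := (P.hHat_star_mul_self_nonneg (1 + Complex.I • x)).2
  simp [mul_add, add_mul, smul_smul] at h0 hx h1 h2
  apply Complex.ext <;> simp <;> linarith

/-- The Haar functional is faithful. -/
lemma eq_zero_of_hHat_star_mul_self {x : A} (hx : P.hHat (star x * x) = 0) : x = 0 := by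
  have re (y : A) : (P.hHat (star x * y)).re = 0 := by
    have hc : P.hHat (star y * x) = star (P.hHat (star x * y)) := by
      rw [← hHat_star, star_mul, star_star]
    have key (t : ℝ) :
        0 ≤ t * (2 * (P.hHat (star x * y)).re) + (P.hHat (star y * y)).re := by
      have h := (P.hHat_star_mul_self_nonneg ((t : ℂ) • x + y)).1
      simp [mul_add, add_mul, hx, hc] at h
      linarith
    by_contra hne
    have h := key (-((P.hHat (star y * y)).re + 1) / (2 * (P.hHat (star x * y)).re))
    rw [div_mul_cancel₀ _ (by simpa using hne)] at h
    linarith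
  have zero (y : A) : P.hHat (star x * y) = 0 := by
    apply Complex.ext
    · exact re y
    · simpa using re (Complex.I • y)
  have hS := P.rapp_hHat_mulLeft (star x)
  rw [show P.hHat ∘ₗ LinearMap.mulLeft ℂ (star x) = 0 from LinearMap.ext zero] at hS
  have hS' : P.W.S (star x) = 0 := by
    have : P.W.S (star x) * (P.gL * P.gL) = 0 := by rw [← hS]; simp [rapp]
    exact ((P.gL_unit.mul P.gL_unit).mul_left_eq_zero).1 this
  simpa using hS'

lemma isUnit_jayEl : IsUnit P.jayEl := by
  have inj {c : A} (hc : P.W.IsRight c) (h : P.jayEl * c = 0) : c = 0 := by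
    have hE : lapp P.hHat (P.W.Δ (star c * (c * (Ring.inverse P.gL * Ring.inverse P.gL)))) = 0 := by
      rw [hc.star.Δ_mul_left, lapp_one_tmul_mul, hc.Δ_mul_left, lapp_one_tmul_mul]
      change star c * (c * P.jayEl) = 0
      rw [← (P.jayEl_commute c).eq, h, mul_zero]
    have hz := apply_lapp P.W.ε P.hHat
      (P.W.Δ (star c * (c * (Ring.inverse P.gL * Ring.inverse P.gL))))
    rw [hE, map_zero, WeakHopfData.rapp_ε_Δ] at hz
    have hcomm : c * Ring.inverse P.gL = Ring.inverse P.gL * c :=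
      (P.isLeft_inverse_gL.commute hc).symm.eq
    have hcomm' : star c * Ring.inverse P.gL = Ring.inverse P.gL * star c :=
      (P.isLeft_inverse_gL.commute hc.star).symm.eq
    have h0 : c * Ring.inverse P.gL = 0 := by
      apply P.eq_zero_of_hHat_star_mul_self
      rw [hz, star_mul, isSelfAdjoint_inverse_gL, ← hcomm', mul_assoc, ← mul_assoc _ c, ← hcomm,
        mul_assoc c]
    rw [← mul_one c, ← P.inverse_mul_gL, ← mul_assoc, h0, zero_mul]
  let R : Submodule ℂ A :=
    { carrier := {a | P.W.IsRight a}
      add_mem' := fun {a b} ha hb =>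
        ⟨by rw [map_add, ha.1, hb.1, TensorProduct.tmul_add, add_mul],
          by rw [map_add, ha.2, hb.2, TensorProduct.tmul_add, mul_add]⟩
      zero_mem' := ⟨by simp, by simp⟩
      smul_mem' := fun c a ha =>
        ⟨by rw [map_smul, ha.1, TensorProduct.tmul_smul, smul_mul_assoc],
          by rw [map_smul, ha.2, TensorProduct.tmul_smul, mul_smul_comm]⟩ }
  have hR : ∀ a ∈ R, LinearMap.mulLeft ℂ P.jayEl a ∈ R := fun a ha => P.isRight_jayEl.mul ha
  let f : R →ₗ[ℂ] R := (LinearMap.mulLeft ℂ P.jayEl).restrict hR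
  have hf : Function.Injective f := by
    rw [injective_iff_map_eq_zero]
    intro a ha
    exact Subtype.ext (inj a.2 (congrArg Subtype.val ha))
  obtain ⟨b, hb⟩ := LinearMap.surjective_of_injective hf
    ⟨1, by simp [← Algebra.TensorProduct.one_def], by simp [← Algebra.TensorProduct.one_def]⟩
  have hb' : P.jayEl * b = 1 := congrArg Subtype.val hb
  exact ⟨⟨P.jayEl, b, hb', by rw [← (P.jayEl_commute b).eq, hb']⟩, rfl⟩

open scoped ComplexOrder in
/-- The Gram matrices of the Haar functional are positive semidefinite. -/
lemma posSemidef_hHat {ι : Type*} [Fintype ι] (a : ι → A) :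
    (Matrix.of fun i j => P.hHat (star (a i) * a j)).PosSemidef := by
  refine .of_dotProduct_mulVec_nonneg ?_ fun x => ?_
  · ext i j
    simp [← hHat_star]
  · have h : star x ⬝ᵥ ((Matrix.of fun i j => P.hHat (star (a i) * a j)).mulVec x)
        = P.hHat (star (∑ i, x i • a i) * ∑ j, x j • a j) := by
      simp [dotProduct, Matrix.mulVec, Finset.sum_mul, Finset.mul_sum, mul_comm]
      rw [Finset.sum_comm]
      exact Finset.sum_congr rfl fun i _ => Finset.sum_congr rfl fun j _ => by ring
    rw [h, Complex.nonneg_iff]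
    exact ⟨(P.hHat_star_mul_self_nonneg _).1, (P.hHat_star_mul_self_nonneg _).2.symm⟩

open scoped ComplexOrder MatrixOrder in
/-- Complete positivity of `id ⊗ ĥ`. -/
lemma exists_lapp_hHat_eq_sum (u : A ⊗[ℂ] A) : ∃ (n : ℕ) (c : Fin n → A),
    lapp P.hHat (P.W.starT u * u) = ∑ k, star (c k) * c k := by
  obtain ⟨n, a, b, rfl⟩ := TensorProduct.exists_sum_tmul_eq u
  obtain ⟨B, hB⟩ := CStarAlgebra.nonneg_iff_eq_star_mul_self.1 (P.posSemidef_hHat a).nonneg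
  have hij (i j : Fin n) : P.hHat (star (a i) * a j) = ∑ k, star (B k i) * B k j := by
    simpa [Matrix.mul_apply, Matrix.star_eq_conjTranspose] using congrFun (congrFun hB i) j
  refine ⟨n, fun k => ∑ i, B k i • b i, ?_⟩
  simp only [P.W.starT_sum, P.W.starT_tmul, Finset.sum_mul, Finset.mul_sum, map_sum,
    Algebra.TensorProduct.tmul_mul_tmul, lapp_tmul, hij, star_sum, star_smul, Finset.sum_smul,
    smul_mul_smul_comm]
  exact Finset.sum_comm_cycle

lemma isPosElem_sum {n : ℕ} (c : Fin n → A) : IsPosElem (∑ k, star (c k) * c k) := by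
  have : CompleteSpace A := FiniteDimensional.complete ℂ A
  let : CStarAlgebra A := { }
  let := CStarAlgebra.spectralOrder A
  have := CStarAlgebra.spectralOrderedRing A
  exact CStarAlgebra.nonneg_iff_eq_star_mul_self.1
    (Finset.sum_nonneg fun k _ => star_mul_self_nonneg (c k))

lemma isPosElem_jayEl : IsPosElem P.jayEl := by
  obtain ⟨n, c, h⟩ := P.exists_lapp_hHat_eq_sum (P.W.Δ (Ring.inverse P.gL))
  rw [← P.W.Δ_star, ← P.W.Δ_mul, isSelfAdjoint_inverse_gL] at h
  rw [jayEl, h]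
  exact isPosElem_sum c

end HaarPkg

/-- **The element `ȷ`, dual analogue of the Watatani index.**
`⟨ĥ, (gL⁻²)₍₁₎⟩ (gL⁻²)₍₂₎ = ⟨ĥ, (gR⁻²)₍₂₎⟩ (gR⁻²)₍₁₎`, and this element `ȷ` is positive,
invertible, invariant under the antipode, and hypercentral. -/
theorem HaarPkg.jay_hypercentral {A : Type*} [NormedRing A] [StarRing A] [CStarRing A]
    [NormedAlgebra ℂ A] [StarModule ℂ A] [FiniteDimensional ℂ A]
    (P : HaarPkg A) :
    lapp P.hHat (P.W.Δ (Ring.inverse P.gL * Ring.inverse P.gL))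
      = rapp P.hHat (P.W.Δ (Ring.inverse P.gR * Ring.inverse P.gR)) ∧
    IsPosElem P.jayEl ∧ IsUnit P.jayEl ∧ P.W.S P.jayEl = P.jayEl ∧
    P.jayEl ∈ Set.range (WeakHopfData.εL P.W) ∧
    P.jayEl ∈ Set.range (WeakHopfData.εR P.W) ∧
    P.jayEl ∈ Set.center A := by
  exact ⟨P.jayEl_eq_rapp, P.isPosElem_jayEl, P.isUnit_jayEl, P.S_jayEl,
    ⟨_, P.isLeft_jayEl.εL_eq⟩, ⟨_, P.isRight_jayEl.εR_eq⟩,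
    Semigroup.mem_center_iff.2 fun x => (P.jayEl_commute x).symm⟩

end
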